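/- arXiv:2412.11319 — 3 statements merged into one kernel-verified Lean document; each statement's English description precedes it below -/
import Mathlib

section
/- Let u = T be the Prouhet–Thue–Morse sequence. Then in the field K = Frac(ℤ[a,b]) the set of quotients {f(n+1)/f(n) : n ∈ ℕ} equals the seven-element set {dᵢ/dᵢ₋₁ : i ∈ {0,1,2,3,4,5,6}}. -/
open MvPolynomial

/-- The indeterminate `a` in `ℤ[a,b]`. -/
noncomputable def pa : MvPolynomial (Fin 2) ℤ := X 0
/-- The indeterminate `b` in `ℤ[a,b]`. -/
noncomputable def pb : MvPolynomial (Fin 2) ℤ := X 1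

/-- The Prouhet–Thue–Morse sequence: sum of binary digits of `n` mod 2. -/
def PTM (n : ℕ) : ℕ := (Nat.digits 2 n).sum % 2

/-- `dpoly k` is the polynomial `d_{k-1}` from the paper, so `dpoly 0 = d₋₁ = 1`,
`dpoly 1 = d₀ = 1`, ..., `dpoly 7 = d₆`. -/
noncomputable def dpoly : ℕ → MvPolynomial (Fin 2) ℤ
  | 0 => 1
  | 1 => 1
  | 2 => pa + pb
  | 3 => pa ^ 2 + pa * pb + pb
  | 4 => pa ^ 3 + pa ^ 2 * pb + 2 * pa * pb + pb ^ 2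
  | 5 => pa ^ 4 + pa ^ 3 * pb + 3 * pa ^ 2 * pb + 2 * pa * pb ^ 2 + pb ^ 2
  | 6 => pa ^ 5 + pa ^ 4 * pb + 4 * pa ^ 3 * pb + 3 * pa ^ 2 * pb ^ 2
          + 3 * pa * pb ^ 2 + pb ^ 3
  | 7 => pa ^ 6 + pa ^ 5 * pb + 5 * pa ^ 4 * pb + 4 * pa ^ 3 * pb ^ 2
          + 6 * pa ^ 2 * pb ^ 2 + 3 * pa * pb ^ 3 + pb ^ 3
  | _ => 1

theorem PTM_even (n : ℕ) : PTM (2 * n) = PTM n := by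
  unfold PTM
  rcases Nat.eq_zero_or_pos n with rfl | h
  · rfl
  · rw [Nat.digits_def' (by norm_num) (by omega)]
    simp

theorem PTM_lt (n : ℕ) : PTM n < 2 := Nat.mod_lt _ (by norm_num)

theorem PTM_odd (n : ℕ) : PTM (2 * n + 1) = 1 - PTM n := by
  unfold PTM
  rw [Nat.digits_def' (by norm_num) (by omega)]
  have h1 : (2 * n + 1) % 2 = 1 := by omega
  have h2 : (2 * n + 1) / 2 = n := by omega
  rw [h1, h2, List.sum_cons]
  omega

/-- Values of the Thue-Morse sequence on a block of length eight. -/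
theorem PTM_block (m : ℕ) :
    PTM (8 * m) = PTM m ∧ PTM (8 * m + 1) = 1 - PTM m ∧ PTM (8 * m + 2) = 1 - PTM m ∧
    PTM (8 * m + 3) = PTM m ∧ PTM (8 * m + 4) = 1 - PTM m ∧ PTM (8 * m + 5) = PTM m ∧
    PTM (8 * m + 6) = PTM m ∧ PTM (8 * m + 7) = 1 - PTM m := by
  have h := PTM_lt m
  have e0 := PTM_even m
  have o0 := PTM_odd m
  have a0 := PTM_even (2 * m)
  have a1 := PTM_odd (2 * m)
  have a2 := PTM_even (2 * m + 1)
  have a3 := PTM_odd (2 * m + 1)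
  have b0 := PTM_even (2 * (2 * m))
  have b1 := PTM_odd (2 * (2 * m))
  have b2 := PTM_even (2 * (2 * m) + 1)
  have b3 := PTM_odd (2 * (2 * m) + 1)
  have b4 := PTM_even (2 * (2 * m + 1))
  have b5 := PTM_odd (2 * (2 * m + 1))
  have b6 := PTM_even (2 * (2 * m + 1) + 1)
  have b7 := PTM_odd (2 * (2 * m + 1) + 1)
  ring_nf at *
  omega

abbrev KK := FractionRing (MvPolynomial (Fin 2) ℤ)

noncomputable def ph : MvPolynomial (Fin 2) ℤ →+* KK :=
  algebraMap (MvPolynomial (Fin 2) ℤ) KK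

theorem ph_inj : Function.Injective ph := IsFractionRing.injective _ _

noncomputable def ev : MvPolynomial (Fin 2) ℤ →+* ℤ := MvPolynomial.eval (fun _ => 1)

theorem ev_pa : ev pa = 1 := by simp [ev, pa]
theorem ev_pb : ev pb = 1 := by simp [ev, pb]

noncomputable def qq (i : ℕ) : KK := ph (dpoly (i + 1)) / ph (dpoly i)

theorem ev_dpoly (i : ℕ) (hi : i < 8) : ev (dpoly i) = Nat.fib (i + 1) := by
  interval_cases i <;> simp [dpoly, ev_pa, ev_pb, Nat.fib_add_two, map_ofNat]

theorem ph_ne {p : MvPolynomial (Fin 2) ℤ} (h : 0 < ev p) : ph p ≠ 0 := by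
  intro h0
  have : p = 0 := ph_inj (by rw [h0, map_zero])
  rw [this, map_zero] at h
  exact lt_irrefl _ h

theorem dpoly_ne (i : ℕ) (hi : i < 8) : ph (dpoly i) ≠ 0 := by
  apply ph_ne
  rw [ev_dpoly i hi]
  exact_mod_cast Nat.fib_pos.2 (by omega)

theorem dpoly_rec (i : ℕ) (hi : i < 6) :
    dpoly (i + 2) = pa * dpoly (i + 1) + pb * dpoly i := by
  interval_cases i <;> simp only [dpoly] <;> ring

theorem qq_succ (i : ℕ) (hi : i < 6) : qq (i + 1) = ph pa + ph pb / qq i := by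
  have h1 := dpoly_ne i (by omega)
  have h2 := dpoly_ne (i + 1) (by omega)
  unfold qq
  rw [dpoly_rec i hi, map_add, map_mul, map_mul]
  field_simp

theorem qq_zero : qq 0 = 1 := by simp [qq, dpoly]

theorem qq_inj (i j : ℕ) (hi : i < 7) (hj : j < 7) (h : qq i = qq j) : i = j := by
  unfold qq at h
  rw [div_eq_div_iff (dpoly_ne i (by omega)) (dpoly_ne j (by omega)), ← map_mul, ← map_mul] at h
  have h2 := congrArg ev (ph_inj h)
  rw [map_mul, map_mul, ev_dpoly _ (by omega), ev_dpoly _ (by omega), ev_dpoly _ (by omega),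
    ev_dpoly _ (by omega)] at h2
  norm_cast at h2
  revert h2
  clear h
  interval_cases i <;> interval_cases j <;> decide

theorem ev_pos (f : ℕ → MvPolynomial (Fin 2) ℤ)
    (hf0 : f 0 = 1) (hf1 : f 1 = 1) (hf2 : f 2 = pa + pb)
    (hfrec : ∀ n, 3 ≤ n → f n = pa * f (n - PTM n - 1) + pb * f (n - PTM n - 2)) (n : ℕ) :
    0 < ev (f n) := by
  induction n using Nat.strong_induction_on with
  | _ n ih =>
    by_cases h : 3 ≤ n
    · rw [hfrec n h, map_add, map_mul, map_mul, ev_pa, ev_pb]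
      have h1 := ih (n - PTM n - 1) (by omega)
      have h2 := ih (n - PTM n - 2) (by omega)
      linarith
    · interval_cases n
      · simp [hf0]
      · simp [hf1]
      · simp [hf2, ev_pa, ev_pb]

/-- The quotient `f (n+1) / f n` in the fraction field. -/
noncomputable def rr (f : ℕ → MvPolynomial (Fin 2) ℤ) (n : ℕ) : KK := ph (f (n + 1)) / ph (f n)

section
variable (f : ℕ → MvPolynomial (Fin 2) ℤ)
    (hf0 : f 0 = 1) (hf1 : f 1 = 1) (hf2 : f 2 = pa + pb)
    (hfrec : ∀ n, 3 ≤ n → f n = pa * f (n - PTM n - 1) + pb * f (n - PTM n - 2))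
    (hne : ∀ n, ph (f n) ≠ 0)

include hfrec hne

theorem step0 (n i : ℕ) (hn : 1 ≤ n) (ht : PTM (n + 2) = 0) (hi : i < 6)
    (h : rr f n = qq i) : rr f (n + 1) = qq (i + 1) := by
  rw [qq_succ i hi, ← h]
  have e := hfrec (n + 2) (by omega)
  rw [ht, show n + 2 - 0 - 1 = n + 1 by omega, show n + 2 - 0 - 2 = n by omega] at e
  have h1 := hne n
  have h2 := hne (n + 1)
  unfold rr
  rw [show n + 1 + 1 = n + 2 by omega, e, map_add, map_mul, map_mul]
  field_simp

theorem feq (n : ℕ) (hn : 1 ≤ n) (ht : PTM (n + 2) = 0) (ht' : PTM (n + 3) = 1) :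
    f (n + 3) = f (n + 2) := by
  have e := hfrec (n + 2) (by omega)
  have e' := hfrec (n + 3) (by omega)
  rw [ht, show n + 2 - 0 - 1 = n + 1 by omega, show n + 2 - 0 - 2 = n by omega] at e
  rw [ht', show n + 3 - 1 - 1 = n + 1 by omega, show n + 3 - 1 - 2 = n by omega] at e'
  rw [e, e']

theorem step1 (n : ℕ) (hn : 1 ≤ n) (ht : PTM (n + 2) = 0) (ht' : PTM (n + 3) = 1) :
    rr f (n + 2) = qq 0 := by
  have e := feq f hfrec hne n hn ht ht'
  unfold rr
  rw [show n + 2 + 1 = n + 3 by omega, e, qq_zero, div_self (hne _)]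

theorem step2 (n i : ℕ) (hn : 1 ≤ n) (ht : PTM (n + 2) = 0) (ht' : PTM (n + 3) = 1)
    (ht2 : PTM (n + 4) = 1) (hi : i < 6)
    (h : rr f (n + 1) = qq i) : rr f (n + 3) = qq (i + 1) := by
  have e := feq f hfrec hne n hn ht ht'
  have e' := hfrec (n + 4) (by omega)
  rw [ht2, show n + 4 - 1 - 1 = n + 2 by omega, show n + 4 - 1 - 2 = n + 1 by omega] at e'
  rw [qq_succ i hi, ← h]
  have h1 := hne (n + 1)
  have h2 := hne (n + 2)
  unfold rr
  rw [show n + 3 + 1 = n + 4 by omega, e', e, show n + 1 + 1 = n + 2 by omega, map_add, map_mul,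
    map_mul]
  field_simp

theorem block00 (m : ℕ) (hs : PTM m = 0) (ht : PTM (m + 1) = 0)
    (h6 : rr f (8 * m + 5) = qq 2) (h7 : rr f (8 * m + 6) = qq 0) :
    rr f (8 * m + 7) = qq 1 ∧ rr f (8 * m + 8) = qq 0 ∧ rr f (8 * m + 9) = qq 2
    ∧ rr f (8 * m + 10) = qq 3 ∧ rr f (8 * m + 11) = qq 0 ∧ rr f (8 * m + 12) = qq 1
    ∧ rr f (8 * m + 13) = qq 2 ∧ rr f (8 * m + 14) = qq 0 := by
  obtain ⟨s0, s1, s2, s3, s4, s5, s6, s7⟩ := PTM_block m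
  obtain ⟨t8, t9, t10, t11, t12, t13, t14, t15⟩ := PTM_block (m + 1)
  rw [hs] at s0 s1 s2 s3 s4 s5 s6 s7
  rw [ht] at t8 t9 t10 t11 t12 t13 t14 t15
  have h8 := step0 f hfrec hne (8 * m + 6) 0 (by omega) t8 (by norm_num) h7
  have h9 := step1 f hfrec hne (8 * m + 6) (by omega) t8 t9
  have h10 := step2 f hfrec hne (8 * m + 6) 1 (by omega) t8 t9 t10
    (by norm_num) h8
  have h11 := step0 f hfrec hne (8 * m + 9) 2 (by omega) t11 (by norm_num) h10
  have h12 := step1 f hfrec hne (8 * m + 9) (by omega) t11 t12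
  have h13 := step0 f hfrec hne (8 * m + 11) 0 (by omega) t13 (by norm_num) h12
  have h14 := step0 f hfrec hne (8 * m + 12) 1 (by omega) t14 (by norm_num) h13
  have h15 := step1 f hfrec hne (8 * m + 12) (by omega) t14 t15
  exact ⟨h8, h9, h10, h11, h12, h13, h14, h15⟩

theorem block01 (m : ℕ) (hs : PTM m = 0) (ht : PTM (m + 1) = 1)
    (h6 : rr f (8 * m + 5) = qq 2) (h7 : rr f (8 * m + 6) = qq 0) :
    rr f (8 * m + 7) = qq 3 ∧ rr f (8 * m + 8) = qq 4 ∧ rr f (8 * m + 9) = qq 5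
    ∧ rr f (8 * m + 10) = qq 0 ∧ rr f (8 * m + 11) = qq 1 ∧ rr f (8 * m + 12) = qq 0
    ∧ rr f (8 * m + 13) = qq 2 ∧ rr f (8 * m + 14) = qq 3 := by
  obtain ⟨s0, s1, s2, s3, s4, s5, s6, s7⟩ := PTM_block m
  obtain ⟨t8, t9, t10, t11, t12, t13, t14, t15⟩ := PTM_block (m + 1)
  rw [hs] at s0 s1 s2 s3 s4 s5 s6 s7
  rw [ht] at t8 t9 t10 t11 t12 t13 t14 t15
  have h8 := step2 f hfrec hne (8 * m + 4) 2 (by omega) s6 s7 t8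
    (by norm_num) h6
  have h9 := step0 f hfrec hne (8 * m + 7) 3 (by omega) t9 (by norm_num) h8
  have h10 := step0 f hfrec hne (8 * m + 8) 4 (by omega) t10 (by norm_num) h9
  have h11 := step1 f hfrec hne (8 * m + 8) (by omega) t10 t11
  have h12 := step0 f hfrec hne (8 * m + 10) 0 (by omega) t12 (by norm_num) h11
  have h13 := step1 f hfrec hne (8 * m + 10) (by omega) t12 t13
  have h14 := step2 f hfrec hne (8 * m + 10) 1 (by omega) t12 t13 t14
    (by norm_num) h12
  have h15 := step0 f hfrec hne (8 * m + 13) 2 (by omega) t15 (by norm_num) h14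
  exact ⟨h8, h9, h10, h11, h12, h13, h14, h15⟩

theorem block10 (m : ℕ) (hs : PTM m = 1) (ht : PTM (m + 1) = 0)
    (h6 : rr f (8 * m + 5) = qq 2) (h7 : rr f (8 * m + 6) = qq 3) :
    rr f (8 * m + 7) = qq 4 ∧ rr f (8 * m + 8) = qq 0 ∧ rr f (8 * m + 9) = qq 5
    ∧ rr f (8 * m + 10) = qq 6 ∧ rr f (8 * m + 11) = qq 0 ∧ rr f (8 * m + 12) = qq 1
    ∧ rr f (8 * m + 13) = qq 2 ∧ rr f (8 * m + 14) = qq 0 := by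
  obtain ⟨s0, s1, s2, s3, s4, s5, s6, s7⟩ := PTM_block m
  obtain ⟨t8, t9, t10, t11, t12, t13, t14, t15⟩ := PTM_block (m + 1)
  rw [hs] at s0 s1 s2 s3 s4 s5 s6 s7
  rw [ht] at t8 t9 t10 t11 t12 t13 t14 t15
  have h8 := step0 f hfrec hne (8 * m + 6) 3 (by omega) t8 (by norm_num) h7
  have h9 := step1 f hfrec hne (8 * m + 6) (by omega) t8 t9
  have h10 := step2 f hfrec hne (8 * m + 6) 4 (by omega) t8 t9 t10
    (by norm_num) h8
  have h11 := step0 f hfrec hne (8 * m + 9) 5 (by omega) t11 (by norm_num) h10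
  have h12 := step1 f hfrec hne (8 * m + 9) (by omega) t11 t12
  have h13 := step0 f hfrec hne (8 * m + 11) 0 (by omega) t13 (by norm_num) h12
  have h14 := step0 f hfrec hne (8 * m + 12) 1 (by omega) t14 (by norm_num) h13
  have h15 := step1 f hfrec hne (8 * m + 12) (by omega) t14 t15
  exact ⟨h8, h9, h10, h11, h12, h13, h14, h15⟩

theorem block11 (m : ℕ) (hs : PTM m = 1) (ht : PTM (m + 1) = 1)
    (h6 : rr f (8 * m + 5) = qq 2) (h7 : rr f (8 * m + 6) = qq 3) :
    rr f (8 * m + 7) = qq 0 ∧ rr f (8 * m + 8) = qq 1 ∧ rr f (8 * m + 9) = qq 2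
    ∧ rr f (8 * m + 10) = qq 0 ∧ rr f (8 * m + 11) = qq 1 ∧ rr f (8 * m + 12) = qq 0
    ∧ rr f (8 * m + 13) = qq 2 ∧ rr f (8 * m + 14) = qq 3 := by
  obtain ⟨s0, s1, s2, s3, s4, s5, s6, s7⟩ := PTM_block m
  obtain ⟨t8, t9, t10, t11, t12, t13, t14, t15⟩ := PTM_block (m + 1)
  rw [hs] at s0 s1 s2 s3 s4 s5 s6 s7
  rw [ht] at t8 t9 t10 t11 t12 t13 t14 t15
  have h8 := step1 f hfrec hne (8 * m + 5) (by omega) s7 t8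
  have h9 := step0 f hfrec hne (8 * m + 7) 0 (by omega) t9 (by norm_num) h8
  have h10 := step0 f hfrec hne (8 * m + 8) 1 (by omega) t10 (by norm_num) h9
  have h11 := step1 f hfrec hne (8 * m + 8) (by omega) t10 t11
  have h12 := step0 f hfrec hne (8 * m + 10) 0 (by omega) t12 (by norm_num) h11
  have h13 := step1 f hfrec hne (8 * m + 10) (by omega) t12 t13
  have h14 := step2 f hfrec hne (8 * m + 10) 1 (by omega) t12 t13 t14
    (by norm_num) h12
  have h15 := step0 f hfrec hne (8 * m + 13) 2 (by omega) t15 (by norm_num) h14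
  exact ⟨h8, h9, h10, h11, h12, h13, h14, h15⟩

include hf0 hf1 hf2

theorem block_init : rr f 0 = qq 0 ∧ rr f 1 = qq 1 ∧ rr f 2 = qq 2 ∧ rr f 3 = qq 0 ∧
    rr f 4 = qq 1 ∧ rr f 5 = qq 2 ∧ rr f 6 = qq 0 := by
  have t3 : PTM 3 = 0 := by norm_num [PTM]
  have t4 : PTM 4 = 1 := by norm_num [PTM]
  have t5 : PTM 5 = 0 := by norm_num [PTM]
  have t6 : PTM 6 = 0 := by norm_num [PTM]
  have t7 : PTM 7 = 1 := by norm_num [PTM]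
  have h1 : rr f 0 = qq 0 := by simp [rr, qq_zero, hf0, hf1]
  have h2 : rr f 1 = qq 1 := by simp [rr, qq, dpoly, hf1, hf2]
  have h3 := step0 f hfrec hne 1 1 (by omega) t3 (by norm_num) h2
  have h4 := step1 f hfrec hne 1 (by omega) t3 t4
  have h5 := step0 f hfrec hne 3 0 (by omega) t5 (by norm_num) h4
  have h6 := step0 f hfrec hne 4 1 (by omega) t6 (by norm_num) h5
  have h7 := step1 f hfrec hne 4 (by omega) t6 t7
  exact ⟨h1, h2, h3, h4, h5, h6, h7⟩

theorem block_end (m : ℕ) : rr f (8 * m + 5) = qq 2 ∧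
    (PTM m = 0 → rr f (8 * m + 6) = qq 0) ∧ (PTM m = 1 → rr f (8 * m + 6) = qq 3) := by
  induction m with
  | zero =>
    obtain ⟨-, -, -, -, -, h6, h7⟩ := block_init f hf0 hf1 hf2 hfrec hne
    exact ⟨h6, fun _ => h7, fun h => by simp [PTM] at h⟩
  | succ m ih =>
    obtain ⟨i1, i2, i3⟩ := ih
    have hs : PTM m = 0 ∨ PTM m = 1 := by have := PTM_lt m; omega
    have ht : PTM (m + 1) = 0 ∨ PTM (m + 1) = 1 := by have := PTM_lt (m + 1); omega
    rw [show 8 * (m + 1) + 5 = 8 * m + 13 by omega, show 8 * (m + 1) + 6 = 8 * m + 14 by omega]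
    rcases hs with hs | hs <;> rcases ht with ht | ht
    · obtain ⟨-, -, -, -, -, -, h14, h15⟩ := block00 f hfrec hne m hs ht i1 (i2 hs)
      exact ⟨h14, fun _ => h15, fun h => by omega⟩
    · obtain ⟨-, -, -, -, -, -, h14, h15⟩ := block01 f hfrec hne m hs ht i1 (i2 hs)
      exact ⟨h14, fun h => by omega, fun _ => h15⟩
    · obtain ⟨-, -, -, -, -, -, h14, h15⟩ := block10 f hfrec hne m hs ht i1 (i3 hs)
      exact ⟨h14, fun _ => h15, fun h => by omega⟩
    · obtain ⟨-, -, -, -, -, -, h14, h15⟩ := block11 f hfrec hne m hs ht i1 (i3 hs)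
      exact ⟨h14, fun h => by omega, fun _ => h15⟩

theorem all_mem (n : ℕ) : ∃ i < 7, rr f n = qq i := by
  by_cases hn : n < 7
  · obtain ⟨h1, h2, h3, h4, h5, h6, h7⟩ := block_init f hf0 hf1 hf2 hfrec hne
    interval_cases n
    exacts [⟨_, by norm_num, h1⟩, ⟨_, by norm_num, h2⟩, ⟨_, by norm_num, h3⟩,
      ⟨_, by norm_num, h4⟩, ⟨_, by norm_num, h5⟩, ⟨_, by norm_num, h6⟩, ⟨_, by norm_num, h7⟩]
  · obtain ⟨m, k, hk, rfl⟩ : ∃ m k, k < 8 ∧ n = 8 * m + (k + 7) :=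
      ⟨(n - 7) / 8, (n - 7) % 8, by omega, by omega⟩
    clear hn
    obtain ⟨i1, i2, i3⟩ := block_end f hf0 hf1 hf2 hfrec hne m
    have hs : PTM m = 0 ∨ PTM m = 1 := by have := PTM_lt m; omega
    have ht : PTM (m + 1) = 0 ∨ PTM (m + 1) = 1 := by have := PTM_lt (m + 1); omega
    have key : ∀ a b c d e g h l : ℕ, a < 7 → b < 7 → c < 7 → d < 7 → e < 7 → g < 7 → h < 7 →
        l < 7 → (rr f (8 * m + 7) = qq a ∧ rr f (8 * m + 8) = qq b ∧ rr f (8 * m + 9) = qq c ∧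
        rr f (8 * m + 10) = qq d ∧ rr f (8 * m + 11) = qq e ∧ rr f (8 * m + 12) = qq g ∧
        rr f (8 * m + 13) = qq h ∧ rr f (8 * m + 14) = qq l) →
        ∃ i < 7, rr f (8 * m + (k + 7)) = qq i := by
      rintro a b c d e g h l ha hb hc hd he hg hh hl ⟨h8, h9, h10, h11, h12, h13, h14, h15⟩
      interval_cases k
      exacts [⟨a, ha, h8⟩, ⟨b, hb, h9⟩, ⟨c, hc, h10⟩, ⟨d, hd, h11⟩, ⟨e, he, h12⟩, ⟨g, hg, h13⟩,
        ⟨h, hh, h14⟩, ⟨l, hl, h15⟩]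
    rcases hs with hs | hs <;> rcases ht with ht | ht
    · refine key _ _ _ _ _ _ _ _ ?_ ?_ ?_ ?_ ?_ ?_ ?_ ?_
        (block00 f hfrec hne m hs ht i1 (i2 hs)) <;> norm_num
    · refine key _ _ _ _ _ _ _ _ ?_ ?_ ?_ ?_ ?_ ?_ ?_ ?_
        (block01 f hfrec hne m hs ht i1 (i2 hs)) <;> norm_num
    · refine key _ _ _ _ _ _ _ _ ?_ ?_ ?_ ?_ ?_ ?_ ?_ ?_
        (block10 f hfrec hne m hs ht i1 (i3 hs)) <;> norm_num
    · refine key _ _ _ _ _ _ _ _ ?_ ?_ ?_ ?_ ?_ ?_ ?_ ?_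
        (block11 f hfrec hne m hs ht i1 (i3 hs)) <;> norm_num

theorem all_hit (i : ℕ) (hi : i < 7) : ∃ n, rr f n = qq i := by
  obtain ⟨h1, h2, h3, -, -, -, -⟩ := block_init f hf0 hf1 hf2 hfrec hne
  obtain ⟨i1, i2, i3⟩ := block_end f hf0 hf1 hf2 hfrec hne 2
  have t2 : PTM 2 = 1 := by norm_num [PTM]
  have t3 : PTM 3 = 0 := by norm_num [PTM]
  obtain ⟨k4, -, k5, k6, -⟩ := block10 f hfrec hne 2 t2 t3 i1 (i3 t2)
  interval_cases i
  exacts [⟨_, h1⟩, ⟨_, h2⟩, ⟨_, h3⟩, ⟨_, i3 t2⟩, ⟨_, k4⟩, ⟨_, k5⟩, ⟨_, k6⟩]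

end

theorem stmt0 (f : ℕ → MvPolynomial (Fin 2) ℤ)
    (hf0 : f 0 = 1) (hf1 : f 1 = 1) (hf2 : f 2 = pa + pb)
    (hfrec : ∀ n, 3 ≤ n → f n = pa * f (n - PTM n - 1) + pb * f (n - PTM n - 2)) :
    let φ := algebraMap (MvPolynomial (Fin 2) ℤ) (FractionRing (MvPolynomial (Fin 2) ℤ))
    ({x | ∃ n : ℕ, x = φ (f (n + 1)) / φ (f n)} =
      {x | ∃ i : Fin 7, x = φ (dpoly ((i : ℕ) + 1)) / φ (dpoly (i : ℕ))}) ∧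
    {x | ∃ i : Fin 7, x = φ (dpoly ((i : ℕ) + 1)) / φ (dpoly (i : ℕ))}.ncard = 7 := by
  intro φ
  have hne : ∀ n, ph (f n) ≠ 0 := fun n => ph_ne (ev_pos f hf0 hf1 hf2 hfrec n)
  constructor
  · ext x
    constructor
    · rintro ⟨n, rfl⟩
      obtain ⟨i, hi, h⟩ := all_mem f hf0 hf1 hf2 hfrec hne n
      exact ⟨⟨i, hi⟩, h⟩
    · rintro ⟨i, rfl⟩
      obtain ⟨n, h⟩ := all_hit f hf0 hf1 hf2 hfrec hne i i.2
      exact ⟨n, h.symm⟩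
  · have hset : {x | ∃ i : Fin 7, x = φ (dpoly ((i : ℕ) + 1)) / φ (dpoly (i : ℕ))} =
        Set.range (fun i : Fin 7 => qq i) := by
      ext x
      constructor
      · rintro ⟨i, h⟩
        exact ⟨i, h.symm⟩
      · rintro ⟨i, h⟩
        exact ⟨i, h.symm⟩
    rw [hset, ← Set.image_univ, Set.ncard_image_of_injective]
    · simp
    · intro i j h
      exact Fin.ext (qq_inj i j i.2 j.2 h)
end

section
/- Let s : ℕ → {0,1} be an arbitrary sequence, and define u : ℕ → {0,1} by u(n) = 0 if n ≡ 0 or 3 (mod 4), u(n) = 1 if n ≡ 1 (mod 4), and u(n) = s(n) if n ≡ 2 (mod 4); define v : ℕ → {0,1} by v(n) = 1 if n ≡ 1 (mod 4) and v(n) = 0 otherwise. Then in K the quotient f̃(n+1)/f̃(n) depends only on n mod 4, and for n ≡ 0, 1, 2, 3 (mod 4) it equals, respectively, 1, a + b, (a² + ab + b)/(a + b), and (a³ + a²b + 2ab + b²)/(a² + ab + b). -/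
open MvPolynomial

theorem ne_zero_of_eval_one (p : MvPolynomial (Fin 2) ℤ)
    (h : MvPolynomial.eval (fun _ => (1 : ℤ)) p ≠ 0) : p ≠ 0 := by
  rintro rfl
  simp at h

theorem stmt6 (s u v : ℕ → ℕ) (hs : ∀ n, s n = 0 ∨ s n = 1)
    (hu0 : ∀ n, n % 4 = 0 ∨ n % 4 = 3 → u n = 0)
    (hu1 : ∀ n, n % 4 = 1 → u n = 1)
    (hus : ∀ n, n % 4 = 2 → u n = s n)
    (hv1 : ∀ n, n % 4 = 1 → v n = 1)
    (hv0 : ∀ n, n % 4 ≠ 1 → v n = 0)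
    (f : ℕ → MvPolynomial (Fin 2) ℤ)
    (hf0 : f 0 = 1) (hf1 : f 1 = 1) (hf2 : f 2 = pa + pb)
    (hfrec : ∀ n, 3 ≤ n → f n = pa * f (n - 1 - u n) + pb * f (n - 2 - v n)) :
    let φ := algebraMap (MvPolynomial (Fin 2) ℤ) (FractionRing (MvPolynomial (Fin 2) ℤ))
    ∀ n : ℕ,
      (n % 4 = 0 → φ (f (n + 1)) / φ (f n) = 1) ∧
      (n % 4 = 1 → φ (f (n + 1)) / φ (f n) = φ (pa + pb)) ∧
      (n % 4 = 2 → φ (f (n + 1)) / φ (f n) =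
        φ (pa ^ 2 + pa * pb + pb) / φ (pa + pb)) ∧
      (n % 4 = 3 → φ (f (n + 1)) / φ (f n) =
        φ (pa ^ 3 + pa ^ 2 * pb + 2 * pa * pb + pb ^ 2) / φ (pa ^ 2 + pa * pb + pb)) := by
  intro φ
  have hD : (pa ^ 3 + pa ^ 2 * pb + 2 * pa * pb + pb ^ 2) ≠ 0 :=
    ne_zero_of_eval_one _ (by simp [pa, pb])
  have hB : (pa ^ 2 + pa * pb + pb) ≠ 0 :=
    ne_zero_of_eval_one _ (by simp [pa, pb])
  have hA : (pa + pb) ≠ 0 :=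
    ne_zero_of_eval_one _ (by simp [pa, pb])
  have h2 : ∀ k, f (4 * k + 1) = f (4 * k) → f (4 * k + 2) = (pa + pb) * f (4 * k) := by
    intro k hk
    rcases Nat.eq_zero_or_pos k with rfl | hpos
    · simp [hf2, hf0]
    · rw [hfrec _ (by omega), hus _ (by omega), hv0 _ (by omega)]
      rcases hs (4 * k + 2) with h | h
      · rw [h, show 4 * k + 2 - 1 - 0 = 4 * k + 1 by omega,
          show 4 * k + 2 - 2 - 0 = 4 * k by omega, hk]
        ring
      · rw [h, show 4 * k + 2 - 1 - 1 = 4 * k by omega,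
          show 4 * k + 2 - 2 - 0 = 4 * k by omega]
        ring
  have h3 : ∀ k, f (4 * k + 1) = f (4 * k) →
      f (4 * k + 3) = (pa ^ 2 + pa * pb + pb) * f (4 * k) := by
    intro k hk
    rw [hfrec _ (by omega), hu0 _ (by omega), hv0 _ (by omega),
      show 4 * k + 3 - 1 - 0 = 4 * k + 2 by omega,
      show 4 * k + 3 - 2 - 0 = 4 * k + 1 by omega, h2 k hk, hk]
    ring
  have h4 : ∀ k, f (4 * k + 1) = f (4 * k) →
      f (4 * k + 4) = (pa ^ 3 + pa ^ 2 * pb + 2 * pa * pb + pb ^ 2) * f (4 * k) := by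
    intro k hk
    rw [hfrec _ (by omega), hu0 _ (by omega), hv0 _ (by omega),
      show 4 * k + 4 - 1 - 0 = 4 * k + 3 by omega,
      show 4 * k + 4 - 2 - 0 = 4 * k + 2 by omega, h3 k hk, h2 k hk]
    ring
  have h5 : ∀ k, f (4 * k + 1) = f (4 * k) →
      f (4 * k + 5) = (pa ^ 3 + pa ^ 2 * pb + 2 * pa * pb + pb ^ 2) * f (4 * k) := by
    intro k hk
    rw [hfrec _ (by omega), hu1 _ (by omega), hv1 _ (by omega),
      show 4 * k + 5 - 1 - 1 = 4 * k + 3 by omega,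
      show 4 * k + 5 - 2 - 1 = 4 * k + 2 by omega, h3 k hk, h2 k hk]
    ring
  have key : ∀ k, f (4 * k + 1) = f (4 * k) ∧ f (4 * k) ≠ 0 := by
    intro k
    induction k with
    | zero => simp [hf0, hf1]
    | succ k ih =>
      obtain ⟨e, ne⟩ := ih
      rw [show 4 * (k + 1) + 1 = 4 * k + 5 by ring, show 4 * (k + 1) = 4 * k + 4 by ring,
        h5 k e, h4 k e]
      exact ⟨rfl, mul_ne_zero hD ne⟩
  have hφ : ∀ p, p ≠ 0 → φ p ≠ 0 := fun p hp =>
    (map_ne_zero_iff φ (IsFractionRing.injective _ _)).mpr hp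
  intro n
  obtain ⟨e, ne⟩ := key (n / 4)
  have hc := hφ _ ne
  refine ⟨fun h => ?_, fun h => ?_, fun h => ?_, fun h => ?_⟩
  · have hn : n = 4 * (n / 4) := by omega
    generalize n / 4 = k at *
    subst hn
    rw [e, div_self hc]
  · have hn : n = 4 * (n / 4) + 1 := by omega
    generalize n / 4 = k at *
    subst hn
    rw [h2 k e, e, map_mul, mul_div_cancel_right₀ _ hc]
  · have hn : n = 4 * (n / 4) + 2 := by omega
    generalize n / 4 = k at *
    subst hn
    rw [h3 k e, h2 k e, map_mul, map_mul, mul_div_mul_right _ _ hc]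
  · have hn : n = 4 * (n / 4) + 3 := by omega
    generalize n / 4 = k at *
    subst hn
    rw [h4 k e, h3 k e, map_mul, map_mul, mul_div_mul_right _ _ hc]
end

section
/- Suppose u is ultimately periodic: there exist l ≥ 1 and m ∈ ℕ such that u(n + l) = u(n) for all n ≥ m. Then at least one of the following holds: (i) V(f) is finite; (ii) the set of accumulation points of V(f), viewed as a subset of the one-point compactification ℝ ∪ {∞} of ℝ, has at most l elements; (iii) V(f) is dense in ℝ. -/
open Filter Topology

/-- The set of quotients of two real sequences. -/
def QS (x y : ℕ → ℝ) : Set ℝ := {t | ∃ k, x k ≠ 0 ∧ t = y k / x k}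

/-- Accumulation points in the one-point compactification. -/
def AP (Q : Set ℝ) : Set (OnePoint ℝ) :=
  {p | AccPt p (𝓟 ((fun x : ℝ => (x : OnePoint ℝ)) '' Q))}

lemma AP_union (P Q : Set ℝ) : AP (P ∪ Q) = AP P ∪ AP Q := by
  ext p
  simp only [AP, Set.image_union, Set.mem_ofPred_eq, Set.mem_union]
  rw [← sup_principal, accPt_sup]

lemma AP_mono {P Q : Set ℝ} (h : P ⊆ Q) : AP P ⊆ AP Q := by
  intro p hp
  exact AccPt.mono hp (principal_mono.2 (Set.image_mono h))

lemma AP_finite {Q : Set ℝ} (h : Q.Finite) : AP Q = ∅ := by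
  ext p
  simp only [AP, Set.mem_ofPred_eq, Set.mem_empty_iff_false, iff_false]
  intro hp
  have hf : ((fun x : ℝ => (x : OnePoint ℝ)) '' Q \ {p}).Finite := (h.image _).subset Set.sdiff_subset
  have h2 := hf.isClosed.isOpen_compl.mem_nhds (x := p) (by simp)
  rw [accPt_iff_nhds] at hp
  obtain ⟨y, ⟨hy1, hy2⟩, hy3⟩ := hp _ h2
  exact hy1 ⟨hy2, hy3⟩

lemma AP_biUnion {ι : Type*} (s : Finset ι) (Q : ι → Set ℝ) :
    AP (⋃ i ∈ s, Q i) = ⋃ i ∈ s, AP (Q i) := by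
  classical
  induction s using Finset.induction_on with
  | empty => simp [AP_finite]
  | insert i s hi ih =>
    rw [Finset.set_biUnion_insert, Finset.set_biUnion_insert, AP_union, ih]

/-- Main per-sequence property. -/
def Good (Q : Set ℝ) : Prop := Dense Q ∨ (AP Q).Subsingleton

lemma Good.of_finite {Q : Set ℝ} (h : Q.Finite) : Good Q := by
  right; rw [AP_finite h]; exact Set.subsingleton_empty

lemma QS_split (x y : ℕ → ℝ) (N : ℕ) :
    QS x y ⊆ ((fun k => y k / x k) '' (Set.Iio N)) ∪ QS (fun k => x (k + N)) (fun k => y (k + N)) := by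
  rintro t ⟨k, hk, rfl⟩
  rcases lt_or_ge k N with h | h
  · left; exact ⟨k, h, rfl⟩
  · right; exact ⟨k - N, by simpa [Nat.sub_add_cancel h] using hk, by simp [Nat.sub_add_cancel h]⟩

lemma QS_shift_subset (x y : ℕ → ℝ) (N : ℕ) :
    QS (fun k => x (k + N)) (fun k => y (k + N)) ⊆ QS x y := by
  rintro t ⟨k, hk, rfl⟩
  exact ⟨k + N, hk, rfl⟩

lemma Good.of_shift {x y : ℕ → ℝ} (N : ℕ)
    (h : Good (QS (fun k => x (k + N)) (fun k => y (k + N)))) : Good (QS x y) := by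
  rcases h with h | h
  · left; exact h.mono (QS_shift_subset x y N)
  · right
    refine h.anti ((AP_mono (QS_split x y N)).trans ?_)
    rw [AP_union, AP_finite ((Set.finite_Iio N).image _), Set.empty_union]

lemma Good.of_range_finite {x y : ℕ → ℝ} (S : Set ℝ) (hS : S.Finite)
    (h : ∀ k, x k ≠ 0 → y k / x k ∈ S) : Good (QS x y) := by
  apply Good.of_finite (hS.subset _)
  rintro t ⟨k, hk, rfl⟩; exact h k hk

/-- constant ratio -/
lemma Good.of_prop {x y s : ℕ → ℝ} (β β' : ℝ) (hx : ∀ k, x k = β * s k) (hy : ∀ k, y k = β' * s k) :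
    Good (QS x y) := by
  refine Good.of_range_finite {β' / β} (Set.finite_singleton _) ?_
  intro k hk
  rw [hx] at hk
  rw [hx, hy, mul_div_mul_right _ _ (right_ne_zero_of_mul hk)]; rfl

/-- periodic ratio -/
lemma Good.of_periodic {x y : ℕ → ℝ} (p : ℕ) (hp : 0 < p) (d : ℝ)
    (hx : ∀ k, x (k + p) = d * x k) (hy : ∀ k, y (k + p) = d * y k) :
    Good (QS x y) := by
  refine Good.of_range_finite ((fun k => y k / x k) '' (Set.Iio p))
    ((Set.finite_Iio p).image _) ?_
  intro k
  induction k using Nat.strong_induction_on with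
  | _ k ih =>
    intro hk
    rcases lt_or_ge k p with h | h
    · exact ⟨k, h, rfl⟩
    · obtain ⟨j, rfl⟩ := Nat.exists_eq_add_of_le' h
      rw [hx] at hk
      rw [hx, hy, mul_div_mul_left _ _ (left_ne_zero_of_mul hk)]
      exact ih j (by omega) (right_ne_zero_of_mul hk)

lemma AP_of_tendsto {x y : ℕ → ℝ} (p : OnePoint ℝ)
    (h : Tendsto (fun k => ((y k / x k : ℝ) : OnePoint ℝ)) (atTop ⊓ 𝓟 {k | x k ≠ 0}) (𝓝 p)) :
    AP (QS x y) ⊆ {p} := by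
  intro q hq
  by_contra hne
  obtain ⟨U, V, hU, hV, hqU, hpV, hUV⟩ := t2_separation hne
  have h1 := h (hV.mem_nhds hpV)
  rw [mem_map, mem_inf_principal, mem_atTop_sets] at h1
  obtain ⟨N, hN⟩ := h1
  have hq2 : q ∈ AP (QS (fun k => x (k + N)) (fun k => y (k + N))) := by
    have := AP_mono (QS_split x y N) hq
    rwa [AP_union, AP_finite ((Set.finite_Iio N).image _), Set.empty_union] at this
  obtain ⟨z, ⟨hz1, ⟨t, ⟨k, hk, rfl⟩, rfl⟩⟩, -⟩ := accPt_iff_nhds.1 hq2 U (hU.mem_nhds hqU)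
  exact Set.disjoint_left.1 hUV hz1 (hN (k + N) (by omega) hk)

lemma Good.of_dominant {x y s : ℕ → ℝ} (α β : ℝ) (hs : ∀ᶠ k in atTop, s k ≠ 0)
    (hx : Tendsto (fun k => x k / s k) atTop (𝓝 α))
    (hy : Tendsto (fun k => y k / s k) atTop (𝓝 β)) (h : α ≠ 0 ∨ β ≠ 0) : Good (QS x y) := by
  right
  have key : (fun k => (y k / s k) / (x k / s k)) =ᶠ[atTop] fun k => y k / x k := by
    filter_upwards [hs] with k hk
    exact div_div_div_cancel_right₀ hk _ _
  by_cases hα : α = 0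
  · have hβ : β ≠ 0 := by tauto
    subst hα
    refine Set.subsingleton_singleton.anti (AP_of_tendsto OnePoint.infty ?_)
    refine OnePoint.tendsto_coe_infty.comp ?_
    rw [coclosedCompact_eq_cocompact, ← Metric.cobounded_eq_cocompact, ← tendsto_norm_atTop_iff_cobounded]
    have hx' : Tendsto (fun k => ‖x k / s k‖) (atTop ⊓ 𝓟 {k | x k ≠ 0}) (𝓝[>] 0) := by
      rw [tendsto_nhdsWithin_iff]
      constructor
      · simpa using (hx.norm).mono_left inf_le_left
      · filter_upwards [Filter.mem_inf_of_left hs, Filter.mem_inf_of_right (mem_principal_self _)] with k h1 h2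
        exact norm_pos_iff.2 (div_ne_zero h2 h1)
    have hy' : Tendsto (fun k => ‖y k / s k‖) (atTop ⊓ 𝓟 {k | x k ≠ 0}) (𝓝 ‖β‖) :=
      hy.norm.mono_left inf_le_left
    have := hy'.pos_mul_atTop (norm_pos_iff.2 hβ) (tendsto_inv_nhdsGT_zero.comp hx')
    refine this.congr' ?_
    filter_upwards [Filter.mem_inf_of_left key] with k hk
    rw [← hk, norm_div _ (x k / s k), div_eq_mul_inv _ ‖x k / s k‖]; rfl
  · refine Set.subsingleton_singleton.anti (AP_of_tendsto ((β / α : ℝ) : OnePoint ℝ) ?_)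
    refine (OnePoint.continuous_coe.tendsto _).comp ?_
    exact ((hy.div hx hα).congr' key).mono_left inf_le_left

lemma circle_cluster (ζ : Circle) (h : ∀ k : ℕ, 0 < k → ζ ^ k ≠ 1) (w : Circle) :
    MapClusterPt w atTop (ζ ^ · : ℕ → Circle) := by
  have h0 : (0:ℝ) < 2 * Real.pi := Real.two_pi_pos
  have : Fact (0 < 2 * Real.pi) := ⟨h0⟩
  obtain ⟨A, rfl⟩ : ∃ A : AddCircle (2 * Real.pi), AddCircle.toCircle A = ζ := 
    ((AddCircle.homeomorphCircle h0.ne').surjective ζ).imp fun A hA => by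
      rw [← hA]; exact (AddCircle.homeomorphCircle_apply h0.ne' A).symm
  have hA : DenseRange (· • A : ℤ → AddCircle (2 * Real.pi)) := by
    rw [AddCircle.denseRange_zsmul_iff, addOrderOf_eq_zero_iff']
    intro k hk hk2
    apply h k hk
    rw [← AddCircle.toCircle_nsmul, hk2, AddCircle.toCircle_zero]
  rw [mapClusterPt_atTop_pow_iff_mem_topologicalClosure_zpowers]
  have hs : Function.Surjective (AddCircle.toCircle : AddCircle (2 * Real.pi) → Circle) := fun ζ =>
    ((AddCircle.homeomorphCircle h0.ne').surjective ζ).imp fun A hA => by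
      rw [← hA]; exact (AddCircle.homeomorphCircle_apply h0.ne' A).symm
  have h2 := hs.denseRange.comp hA AddCircle.continuous_toCircle w
  refine closure_mono ?_ h2
  rintro _ ⟨n, rfl⟩
  exact ⟨n, by simp [AddCircle.toCircle_zsmul]⟩

lemma dense_of_rotation {x y e e' : ℕ → ℝ} {s : ℕ → ℝ} (ζ : Circle) (h : ∀ k : ℕ, 0 < k → ζ ^ k ≠ 1)
    (α β : ℂ) (hαβ : (α * (starRingEnd ℂ) β).im ≠ 0) (hs : ∀ k, s k ≠ 0)
    (he : Tendsto e atTop (𝓝 0)) (he' : Tendsto e' atTop (𝓝 0))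
    (hx : ∀ k, x k = s k * ((α * (ζ : ℂ) ^ k).re + e k))
    (hy : ∀ k, y k = s k * ((β * (ζ : ℂ) ^ k).re + e' k)) : Dense (QS x y) := by
  intro t
  have hγ : β - t * α ≠ 0 := by
    intro h0
    apply hαβ
    have : β = t * α := sub_eq_zero.1 h0
    rw [this]; simp; ring
  set γ := β - t * α with hγd
  have hw : Complex.I * (starRingEnd ℂ) γ / (‖γ‖ : ℂ) ∈ Submonoid.unitSphere ℂ := by
    simp [Submonoid.unitSphere, hγ]
  set w : Circle := ⟨_, hw⟩ with hwd
  have hwc : (w : ℂ) = Complex.I * (starRingEnd ℂ) γ / (‖γ‖ : ℂ) := rfl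
  have hn : ‖γ‖ ≠ 0 := by simpa using hγ
  have h1 : (γ * w).re = 0 := by
    rw [hwc, ← mul_div_assoc]
    have : γ * (Complex.I * (starRingEnd ℂ) γ) = Complex.I * (γ * (starRingEnd ℂ) γ) := by ring
    rw [this, Complex.mul_conj, Complex.div_ofReal_re]
    simp
  have h2 : (α * w).re ≠ 0 := by
    rw [hwc, ← mul_div_assoc, Complex.div_ofReal_re]
    refine div_ne_zero ?_ hn
    have : (α * (Complex.I * (starRingEnd ℂ) γ)).re = - (α * (starRingEnd ℂ) β).im := by
      rw [hγd]; simp; ring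
    rw [this]; exact neg_ne_zero.2 hαβ
  have h3 : (β * w).re = t * (α * w).re := by
    have : β * w = γ * w + t * (α * w) := by rw [hγd]; ring
    rw [this, Complex.add_re, h1, Complex.re_ofReal_mul, zero_add]
  obtain ⟨U, hU, hUt⟩ := mapClusterPt_iff_ultrafilter.1 (circle_cluster ζ h w)
  have h4 : Tendsto (fun k => (ζ : ℂ) ^ k) U (𝓝 (w : ℂ)) := by
    have := (continuous_subtype_val.tendsto w).comp hUt
    refine this.congr ?_
    intro k; exact Circle.coe_pow ζ k
  have hX : Tendsto (fun k => (α * (ζ : ℂ) ^ k).re + e k) U (𝓝 ((α * w).re + 0)) :=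
    ((Complex.continuous_re.tendsto _).comp (h4.const_mul α)).add (he.mono_left hU)
  have hY : Tendsto (fun k => (β * (ζ : ℂ) ^ k).re + e' k) U (𝓝 ((β * w).re + 0)) :=
    ((Complex.continuous_re.tendsto _).comp (h4.const_mul β)).add (he'.mono_left hU)
  rw [add_zero] at hX hY
  have hD := hY.div hX h2
  rw [h3, mul_div_cancel_right₀ _ h2] at hD
  refine mem_closure_of_tendsto hD ?_
  filter_upwards [hX.eventually_ne h2] with k hk
  refine ⟨k, ?_, ?_⟩
  · rw [hx]; exact mul_ne_zero (hs k) hk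
  · rw [hx, hy, mul_div_mul_left _ _ (hs k)]; rfl

/-- complex-root representation of an order two recurrence -/
lemma rep_complex {x : ℕ → ℝ} {T D : ℝ} (z : ℂ) (hz : z ^ 2 = T * z - D) (him : z.im ≠ 0)
    (hx : ∀ k, x (k + 2) = T * x (k + 1) - D * x k) : ∃ α : ℂ, ∀ k, x k = (α * z ^ k).re := by
  refine ⟨⟨x 0, (x 0 * z.re - x 1) / z.im⟩, ?_⟩
  set α : ℂ := ⟨x 0, (x 0 * z.re - x 1) / z.im⟩ with hα
  intro k
  induction k using Nat.twoStepInduction with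
  | zero => simp [hα]
  | one => simp [hα]; field_simp; ring
  | more k ih1 ih2 =>
    have : α * z ^ (k + 2) = T * (α * z ^ (k + 1)) - D * (α * z ^ k) := by
      rw [pow_add, hz]; ring
    rw [hx, ih1, ih2, this, Complex.sub_re, Complex.re_ofReal_mul, Complex.re_ofReal_mul]

lemma geo {x : ℕ → ℝ} {c : ℝ} (h : ∀ k, x (k + 1) = c * x k) (k : ℕ) : x k = x 0 * c ^ k := by
  induction k with
  | zero => simp
  | succ k ih => rw [h, ih]; ring

lemma exists_root_complex {T D : ℝ} (h : T ^ 2 - 4 * D < 0) :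
    ∃ z : ℂ, z ^ 2 = T * z - D ∧ z.im ≠ 0 ∧ z.re = T / 2 ∧ ‖z‖ ^ 2 = D := by
  have hp : 0 < Real.sqrt (4 * D - T ^ 2) := Real.sqrt_pos.2 (by linarith)
  have hsq : Real.sqrt (4 * D - T ^ 2) ^ 2 = 4 * D - T ^ 2 := Real.sq_sqrt (by linarith)
  generalize Real.sqrt (4 * D - T ^ 2) = q at hp hsq
  refine ⟨⟨T / 2, q / 2⟩, ?_, ?_, rfl, ?_⟩
  · apply Complex.ext
    · simp [pow_two]; nlinarith
    · simp [pow_two]; ring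
  · simp; exact hp.ne'
  · rw [Complex.sq_norm, Complex.normSq_mk]; nlinarith

/-- complex case with perturbation -/
lemma dense_complex {x y e e' : ℕ → ℝ} (z : ℂ) (hz : z ≠ 0)
    (hroot : ∀ k : ℕ, 0 < k → z ^ k ≠ (‖z‖ : ℂ) ^ k)
    (α β : ℂ) (hαβ : (α * (starRingEnd ℂ) β).im ≠ 0)
    (he : Tendsto (fun k => e k / ‖z‖ ^ k) atTop (𝓝 0))
    (he' : Tendsto (fun k => e' k / ‖z‖ ^ k) atTop (𝓝 0))
    (hx : ∀ k, x k = (α * z ^ k).re + e k) (hy : ∀ k, y k = (β * z ^ k).re + e' k) :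
    Dense (QS x y) := by
  have hn : ‖z‖ ≠ 0 := by simpa using hz
  have hnc : (‖z‖ : ℂ) ≠ 0 := by exact_mod_cast hn
  have hw : z / (‖z‖ : ℂ) ∈ Submonoid.unitSphere ℂ := by
    simp [Submonoid.unitSphere, hz]
  have key : ∀ (γ : ℂ) (k : ℕ), (γ * z ^ k).re = ‖z‖ ^ k * (γ * (z / (‖z‖ : ℂ)) ^ k).re := by
    intro γ k
    rw [← Complex.re_ofReal_mul]
    congr 1
    push_cast
    rw [div_pow]
    field_simp
  obtain ⟨w, hwz⟩ : ∃ w : Circle, (w : ℂ) = z / (‖z‖ : ℂ) := ⟨⟨_, hw⟩, rfl⟩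
  rw [← hwz] at key
  refine dense_of_rotation (s := fun k => ‖z‖ ^ k) w ?_ α β hαβ (fun k => pow_ne_zero _ hn)
    he he' ?_ ?_
  · intro k hk h
    have h2 := congrArg (fun w : Circle => (w : ℂ)) h
    simp only [Circle.coe_pow, Circle.coe_one] at h2
    apply hroot k hk
    rw [hwz, div_pow, div_eq_one_iff_eq (pow_ne_zero _ hnc)] at h2
    exact h2
  · intro k
    rw [hx, key, mul_add, mul_div_cancel₀ _ (pow_ne_zero _ hn)]
  · intro k
    rw [hy, key, mul_add, mul_div_cancel₀ _ (pow_ne_zero _ hn)]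

lemma good_complex {x y : ℕ → ℝ} (T D : ℝ)
    (hx : ∀ k, x (k + 2) = T * x (k + 1) - D * x k)
    (hy : ∀ k, y (k + 2) = T * y (k + 1) - D * y k) (hd : T ^ 2 - 4 * D < 0) : Good (QS x y) := by
  obtain ⟨z, hz, him, -, -⟩ := exists_root_complex hd
  obtain ⟨α, hα⟩ := rep_complex z hz him hx
  obtain ⟨β, hβ⟩ := rep_complex z hz him hy
  have hz0 : z ≠ 0 := by rintro rfl; simp at him
  by_cases hroot : ∀ k : ℕ, 0 < k → z ^ k ≠ (‖z‖ : ℂ) ^ k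
  · by_cases hαβ : (α * (starRingEnd ℂ) β).im = 0
    · -- proportional
      by_cases hα0 : α = 0
      · refine Good.of_finite (Set.finite_empty.subset ?_)
        rintro t ⟨k, hk, -⟩
        apply hk; rw [hα, hα0]; simp
      · refine Good.of_prop (s := fun k => (α * z ^ k).re) 1 ((α * (starRingEnd ℂ) β).re / ‖α‖ ^ 2)
          (by simpa using hα) ?_
        have hb : β = (((α * (starRingEnd ℂ) β).re / ‖α‖ ^ 2 : ℝ) : ℂ) * α := by
          have hn : (‖α‖ : ℂ) ≠ 0 := by simpa using hα0
          have h1 : α * (starRingEnd ℂ) β = (((α * (starRingEnd ℂ) β).re : ℝ) : ℂ) := by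
            apply Complex.ext <;> simp
            simpa using hαβ
          have h2 := congrArg (starRingEnd ℂ) h1
          simp only [map_mul, Complex.conj_conj, Complex.conj_ofReal] at h2
          push_cast
          rw [← h2]
          have h3 : α * (starRingEnd ℂ) α = (‖α‖ : ℂ) ^ 2 := Complex.mul_conj' α
          field_simp
          rw [← h3]; ring
        intro k
        rw [hβ, ← Complex.re_ofReal_mul, ← mul_assoc, ← hb]
    · left
      refine dense_complex (e := fun _ => 0) (e' := fun _ => 0) z hz0 hroot α β hαβ
        (by simp) (by simp) (by simpa using hα) (by simpa using hβ)
  · push Not at hroot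
    obtain ⟨p, hp, hpz⟩ := hroot
    refine Good.of_periodic p hp (‖z‖ ^ p) ?_ ?_
    · intro k
      rw [hα, hα, ← Complex.re_ofReal_mul, pow_add, hpz]; push_cast; ring_nf
    · intro k
      rw [hβ, hβ, ← Complex.re_ofReal_mul, pow_add, hpz]; push_cast; ring_nf

lemma ratio_pow_tendsto {lam mu : ℝ} (h : |mu| < |lam|) :
    Tendsto (fun k : ℕ => mu ^ k / lam ^ k) atTop (𝓝 0) := by
  simp_rw [← div_pow]
  apply tendsto_pow_atTop_nhds_zero_of_abs_lt_one
  rw [abs_div]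
  exact (div_lt_one (lt_of_le_of_lt (abs_nonneg _) h)).2 h

lemma good_real_lt {x y : ℕ → ℝ} (lam mu : ℝ)
    (hx : ∀ k, x (k + 2) = (lam + mu) * x (k + 1) - (lam * mu) * x k)
    (hy : ∀ k, y (k + 2) = (lam + mu) * y (k + 1) - (lam * mu) * y k)
    (h : |mu| < |lam|) : Good (QS x y) := by
  have hl : lam ≠ 0 := abs_pos.1 (lt_of_le_of_lt (abs_nonneg _) h)
  have hne : lam - mu ≠ 0 := by
    intro h0
    rw [sub_eq_zero.1 h0] at h; exact lt_irrefl _ h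
  have rep : ∀ w : ℕ → ℝ, (∀ k, w (k + 2) = (lam + mu) * w (k + 1) - (lam * mu) * w k) →
      ∃ A B : ℝ, ∀ k, w k = A * lam ^ k + B * mu ^ k := by
    intro w hw
    have h1 := geo (x := fun k => w (k + 1) - mu * w k) (c := lam) (by intro k; simp only [hw]; ring)
    have h2 := geo (x := fun k => w (k + 1) - lam * w k) (c := mu) (by intro k; simp only [hw]; ring)
    refine ⟨(w 1 - mu * w 0) / (lam - mu), -(w 1 - lam * w 0) / (lam - mu), fun k => ?_⟩
    have h1' := h1 k
    have h2' := h2 k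
    simp only [zero_add] at h1' h2'
    field_simp
    linear_combination h1' - h2'
  obtain ⟨A, B, hA⟩ := rep x hx
  obtain ⟨A', B', hA'⟩ := rep y hy
  have lim : ∀ w : ℕ → ℝ, ∀ A B : ℝ, (∀ k, w k = A * lam ^ k + B * mu ^ k) →
      Tendsto (fun k => w k / lam ^ k) atTop (𝓝 A) := by
    intro w A B hw
    have := ((ratio_pow_tendsto h).const_mul B).const_add A
    rw [mul_zero, add_zero] at this
    refine this.congr fun k => ?_
    rw [hw]
    have := pow_ne_zero k hl
    field_simp
  by_cases h0 : A ≠ 0 ∨ A' ≠ 0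
  · exact Good.of_dominant (s := fun k => lam ^ k) A A' (Eventually.of_forall fun k => pow_ne_zero k hl)
      (lim x A B hA) (lim y A' B' hA') h0
  · push Not at h0
    exact Good.of_prop (s := fun k => mu ^ k) B B' (by simpa [h0.1] using hA) (by simpa [h0.2] using hA')

lemma good_real_eq {x y : ℕ → ℝ} (lam : ℝ)
    (hx : ∀ k, x (k + 2) = (lam + lam) * x (k + 1) - (lam * lam) * x k)
    (hy : ∀ k, y (k + 2) = (lam + lam) * y (k + 1) - (lam * lam) * y k) : Good (QS x y) := by
  by_cases hl : lam = 0
  · subst hl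
    apply Good.of_shift 2
    refine Good.of_finite (Set.finite_empty.subset ?_)
    rintro t ⟨k, hk, -⟩
    apply hk; simp [hx]
  have rep : ∀ w : ℕ → ℝ, (∀ k, w (k + 2) = (lam + lam) * w (k + 1) - (lam * lam) * w k) →
      ∃ A B : ℝ, ∀ k, w k = (A + B * k) * lam ^ k := by
    intro w hw
    refine ⟨w 0, w 1 / lam - w 0, fun k => ?_⟩
    induction k using Nat.twoStepInduction with
    | zero => simp
    | one => simp; field_simp
    | more k ih1 ih2 =>
      rw [hw, ih1, ih2]; push_cast; ring
  obtain ⟨A, B, hA⟩ := rep x hx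
  obtain ⟨A', B', hA'⟩ := rep y hy
  have lim : ∀ w : ℕ → ℝ, ∀ A B : ℝ, (∀ k : ℕ, w k = (A + B * k) * lam ^ k) →
      Tendsto (fun k : ℕ => w k / (k * lam ^ k)) atTop (𝓝 B) := by
    intro w A B hw
    have := (tendsto_const_div_atTop_nhds_zero_nat A).add_const B
    rw [zero_add] at this
    refine this.congr' ?_
    filter_upwards [eventually_ge_atTop 1] with k hk
    rw [hw]
    have := pow_ne_zero k hl
    have hk' : (k : ℝ) ≠ 0 := by positivity
    field_simp
  by_cases h0 : B ≠ 0 ∨ B' ≠ 0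
  · refine Good.of_dominant (s := fun k => k * lam ^ k) B B' ?_ (lim x A B hA) (lim y A' B' hA') h0
    filter_upwards [eventually_ge_atTop 1] with k hk
    exact mul_ne_zero (by positivity) (pow_ne_zero k hl)
  · push Not at h0
    exact Good.of_prop (s := fun k => lam ^ k) A A' (by simpa [h0.1] using hA) (by simpa [h0.2] using hA')

lemma good_two {x y : ℕ → ℝ} (T D : ℝ)
    (hx : ∀ k, x (k + 2) = T * x (k + 1) - D * x k)
    (hy : ∀ k, y (k + 2) = T * y (k + 1) - D * y k) : Good (QS x y) := by
  rcases lt_or_ge (T ^ 2 - 4 * D) 0 with hd | hd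
  · exact good_complex T D hx hy hd
  have hsq : Real.sqrt (T ^ 2 - 4 * D) ^ 2 = T ^ 2 - 4 * D := Real.sq_sqrt hd
  obtain ⟨lam, mu, h1, h2⟩ : ∃ lam mu : ℝ, T = lam + mu ∧ D = lam * mu :=
    ⟨(T + Real.sqrt (T ^ 2 - 4 * D)) / 2, (T - Real.sqrt (T ^ 2 - 4 * D)) / 2, by ring, by nlinarith⟩
  subst h1 h2
  rcases lt_trichotomy |mu| |lam| with h | h | h
  · exact good_real_lt lam mu hx hy h
  · rcases abs_eq_abs.1 h with h | h
    · subst h; exact good_real_eq _ hx hy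
    · subst h
      refine Good.of_periodic 2 (by norm_num) (lam * lam) ?_ ?_
      · intro k; rw [hx]; ring
      · intro k; rw [hy]; ring
  · refine good_real_lt mu lam ?_ ?_ h
    · intro k; rw [hx]; ring
    · intro k; rw [hy]; ring

/-- Lucas type polynomials -/
noncomputable def UP (a : ℤ) : ℕ → Polynomial ℚ
  | 0 => 0
  | 1 => 1
  | (n + 2) => -Polynomial.X * UP a (n + 1) - (Polynomial.X ^ 2 - Polynomial.C (a : ℚ)) * UP a n

lemma UP_eval (a : ℤ) (x y1 y2 : ℂ) (h1 : y1 + y2 = -x) (h2 : y1 * y2 = x ^ 2 - a) (n : ℕ) :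
    Polynomial.aeval x (UP a n) * (y1 - y2) = y1 ^ n - y2 ^ n := by
  induction n using Nat.twoStepInduction with
  | zero => simp [UP]
  | one => simp [UP]
  | more n ih1 ih2 =>
    simp only [UP, map_sub, map_mul, map_neg, map_pow, Polynomial.aeval_X, Polynomial.aeval_C]
    have : (algebraMap ℚ ℂ) (a : ℚ) = (a : ℂ) := by simp
    rw [this, sub_mul, mul_assoc, mul_assoc, ih1, ih2, ← h1, ← h2]
    ring

lemma no_root_unity (a b : ℤ) (ha : a < 0) (hb : b ≠ 0) (c : ℝ) (hc : c ^ 3 = a * c + b) (z : ℂ)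
    (hz : z ^ 2 = ((-c : ℝ) : ℂ) * z - ((c ^ 2 - a : ℝ) : ℂ)) (hre : z.re = -c / 2)
    (hn : ‖z‖ ^ 2 = c ^ 2 - a) (k : ℕ) (hk : 0 < k) : z ^ k ≠ (‖z‖ : ℂ) ^ k := by
  intro h
  have haR : (a : ℝ) < 0 := by exact_mod_cast ha
  have hc0 : c ≠ 0 := by
    rintro rfl
    apply hb
    have : (b : ℝ) = 0 := by simpa using hc.symm
    exact_mod_cast this
  have hN : 0 < c ^ 2 - a := by nlinarith [sq_nonneg c]
  set z' := (starRingEnd ℂ) z with hz'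
  have hconj : z' ^ k = (‖z‖ : ℂ) ^ k := by
    have := congrArg (starRingEnd ℂ) h
    simpa using this
  have hsum : z + z' = -c := by
    rw [hz', Complex.add_conj, hre]; push_cast; ring
  have hprod : z * z' = (c : ℂ) ^ 2 - a := by
    rw [hz', Complex.mul_conj']
    have := congrArg (fun r : ℝ => (r : ℂ)) hn
    simpa using this
  have hNc : ((c : ℂ) ^ 2 - a) ≠ 0 := by
    have : ((c ^ 2 - a : ℝ) : ℂ) ≠ 0 := by exact_mod_cast hN.ne'
    simpa using this
  have hz0 : z ≠ 0 := by intro h0; rw [h0, zero_mul] at hprod; exact hNc hprod.symm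
  have hz0' : z' ≠ 0 := by intro h0; rw [h0, mul_zero] at hprod; exact hNc hprod.symm
  have hcC : (c : ℂ) ^ 3 = a * c + b := by exact_mod_cast congrArg (fun r : ℝ => (r : ℂ)) hc
  by_cases hq : ∃ q : ℚ, c = q
  · obtain ⟨q, hq⟩ := hq
    have i1 : IsIntegral ℤ (z / z') := by
      refine .of_pow hk ?_
      rw [div_pow, h, hconj, div_self (by rw [← h]; exact pow_ne_zero _ hz0)]
      exact isIntegral_one
    have i2 : IsIntegral ℤ (z' / z) := by
      refine .of_pow hk ?_
      rw [div_pow, h, hconj, div_self (by rw [← h]; exact pow_ne_zero _ hz0)]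
      exact isIntegral_one
    have hval : z / z' + z' / z = (c ^ 2 - 2 * (c ^ 2 - a)) / ((c : ℂ) ^ 2 - a) := by
      rw [← hprod]
      field_simp
      linear_combination (z + z' - c) * hsum
    obtain ⟨j, hj⟩ := (IsIntegral.exists_int_iff_exists_rat (i1.add i2)).1
      ⟨(q ^ 2 - 2 * (q ^ 2 - a)) / (q ^ 2 - a), by rw [hval, hq]; push_cast; rfl⟩
    rw [hval, div_eq_iff hNc] at hj
    have hj' : c ^ 2 - 2 * (c ^ 2 - a) = j * (c ^ 2 - a) := by exact_mod_cast hj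
    have h5 : ((j : ℝ) + 2) * (c ^ 2 - a) = c ^ 2 := by linarith
    have hc2 : 0 < c ^ 2 := by positivity
    have h6 : 0 < (j : ℝ) + 2 := by
      by_contra hcon
      push Not at hcon
      nlinarith
    have h7 : (j : ℝ) + 2 < 1 := by
      by_contra hcon
      push Not at hcon
      nlinarith
    have h6' : 0 < j + 2 := by exact_mod_cast h6
    have h7' : j + 2 < 1 := by exact_mod_cast h7
    omega
  · set p : Polynomial ℚ := Polynomial.X ^ 3 - Polynomial.C (a : ℚ) * Polynomial.X - Polynomial.C (b : ℚ)
      with hp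
    have hdeg : p.natDegree = 3 := by rw [hp]; compute_degree!
    have hmon : p.Monic := by rw [hp]; monicity!
    have hev : ∀ x : ℂ, Polynomial.aeval x p = x ^ 3 - a * x - b := by
      intro x; simp [hp]
    have hirr : Irreducible p := by
      rw [Polynomial.Monic.irreducible_iff_roots_eq_zero_of_degree_le_three hmon (by omega) (by omega)]
      rw [Multiset.eq_zero_iff_forall_notMem]
      intro q hqr
      rw [Polynomial.mem_roots hmon.ne_zero, Polynomial.IsRoot.def] at hqr
      have hq3 : (q : ℝ) ^ 3 - a * q - b = 0 := by
        have : q ^ 3 - a * q - b = 0 := by simpa [hp] using hqr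
        exact_mod_cast congrArg (fun r : ℚ => (r : ℝ)) this
      apply hq
      refine ⟨q, ?_⟩
      have h8 : (c - q) * (c ^ 2 + c * q + q ^ 2 - a) = 0 := by linear_combination hc - hq3
      rcases mul_eq_zero.1 h8 with h9 | h9
      · linarith
      · nlinarith [sq_nonneg (c + q), sq_nonneg c, sq_nonneg (q : ℝ)]
    have hpc : Polynomial.aeval (c : ℂ) p = 0 := by rw [hev, hcC]; ring
    have hpz : Polynomial.aeval z p = 0 := by
      rw [hev]
      push_cast at hz
      linear_combination (z - c) * hz + hcC
    have hmin := minpoly.eq_of_irreducible_of_monic hirr hpc hmon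
    have hzz : z - z' ≠ 0 := by
      intro h0
      have h1 : z' = z := (sub_eq_zero.1 h0).symm
      have h2 : z.im = 0 := Complex.conj_eq_iff_im.1 h1
      have h3 : ‖z‖ ^ 2 = z.re ^ 2 := by rw [Complex.sq_norm, Complex.normSq_apply, h2]; ring
      rw [hn, hre] at h3
      nlinarith [sq_nonneg c]
    have hU : Polynomial.aeval (c : ℂ) (UP a k) = 0 := by
      have := UP_eval a c z z' hsum hprod k
      rw [h, hconj, sub_self] at this
      exact (mul_eq_zero.1 this).resolve_right hzz
    have hdvd : p ∣ UP a k := by rw [hmin]; exact minpoly.dvd ℚ _ hU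
    have hUz : Polynomial.aeval z (UP a k) = 0 := by
      obtain ⟨r, hr⟩ := hdvd
      rw [hr, map_mul, hpz, zero_mul]
    have h10 := UP_eval a z c z' (by linear_combination hsum)
      (by push_cast at hz; linear_combination -hz + c * hsum) k
    rw [hUz, zero_mul] at h10
    have h11 : (c : ℂ) ^ k = z' ^ k := by linear_combination -h10
    have h12 := congrArg (fun w : ℂ => ‖w‖) h11
    simp only [norm_pow] at h12
    have h13 : ‖(c : ℂ)‖ = ‖z'‖ := (pow_left_inj₀ (norm_nonneg _) (norm_nonneg _) hk.ne').1 h12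
    have h14 : ‖z'‖ = ‖z‖ := by rw [hz']; exact Complex.norm_conj z
    rw [h14, Complex.norm_real, Real.norm_eq_abs] at h13
    rw [← h13, sq_abs] at hn
    linarith

lemma tendsto_zero_of_contract {H : ℕ → ℝ} (z w C : ℝ) (hz : |z| < 1) (hw : |w| < 1)
    (h : ∀ k, H (k + 1) = z * H k + C * w ^ k) : Tendsto H atTop (𝓝 0) := by
  obtain ⟨ρ, hρ0, hρ1, hzρ, hwρ⟩ : ∃ ρ : ℝ, 0 < ρ ∧ ρ < 1 ∧ |z| ≤ ρ ∧ |w| ≤ ρ :=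
    ⟨max (1 / 2) (max |z| |w|), by positivity, by simp [hz, hw]; norm_num, by simp, by simp⟩
  have bound : ∀ k : ℕ, |H k| ≤ (|H 0| + |C| / ρ * k) * ρ ^ k := by
    intro k
    induction k with
    | zero => simp
    | succ k ih =>
      rw [h]
      calc |z * H k + C * w ^ k| ≤ |z * H k| + |C * w ^ k| := abs_add_le _ _
        _ = |z| * |H k| + |C| * |w| ^ k := by rw [abs_mul, abs_mul, abs_pow]
        _ ≤ ρ * ((|H 0| + |C| / ρ * k) * ρ ^ k) + |C| * ρ ^ k := by gcongr
        _ = _ := by push_cast; field_simp; ring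
  refine squeeze_zero_norm bound ?_
  have h1 := (tendsto_pow_atTop_nhds_zero_of_lt_one hρ0.le hρ1).const_mul |H 0|
  have h2 := (tendsto_self_mul_const_pow_of_lt_one hρ0.le hρ1).const_mul (|C| / ρ)
  have := h1.add h2
  simp only [mul_zero, add_zero] at this
  exact this.congr fun k => by ring

lemma exists_big_root_pos {a b : ℝ} (ha : 0 < a) (hb : 0 < b) :
    ∃ c : ℝ, c ^ 3 = a * c + b ∧ a < c ^ 2 := by
  have hs : 0 < Real.sqrt a := Real.sqrt_pos.2 ha
  have hsq : Real.sqrt a ^ 2 = a := Real.sq_sqrt ha.le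
  generalize Real.sqrt a = s at hs hsq
  subst hsq
  have hcont : Continuous fun x : ℝ => x ^ 3 - s ^ 2 * x := by fun_prop
  have := intermediate_value_Icc (show s ≤ s + b + 1 by linarith) hcont.continuousOn
  obtain ⟨c, ⟨hc1, hc2⟩, hc⟩ := this (show b ∈ _ by
    constructor
    · ring_nf; exact hb.le
    · have : (s + b + 1) ^ 3 - s ^ 2 * (s + b + 1) = (s + b + 1) * (2 * s + b + 1) * (b + 1) := by ring
      simp only [this]
      have h1 : 1 ≤ (s + b + 1) * (2 * s + b + 1) := by nlinarith [mul_pos hs hb, mul_pos hs hs, mul_pos hb hb]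
      nlinarith)
  simp only at hc
  refine ⟨c, by linarith, ?_⟩
  rcases hc1.eq_or_lt with h | h
  · subst h; exfalso; ring_nf at hc; linarith
  · nlinarith

lemma exists_big_root {a b : ℝ} (ha : 0 < a) (hb : b ≠ 0) :
    ∃ c : ℝ, c ^ 3 = a * c + b ∧ a < c ^ 2 := by
  rcases lt_or_gt_of_ne hb with h | h
  · obtain ⟨c, h1, h2⟩ := exists_big_root_pos ha (neg_pos.2 h)
    exact ⟨-c, by linear_combination -h1, by linarith [neg_sq c]⟩
  · exact exists_big_root_pos ha h

lemma decay {h : ℕ → ℝ} {c D : ℝ} (hh : ∀ k, h (k + 2) = (-c) * h (k + 1) - D * h k)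
    (hD0 : 0 < D) (hD : D < c ^ 2) : Tendsto (fun k => h k / c ^ k) atTop (𝓝 0) := by
  have hc0 : c ≠ 0 := by rintro rfl; norm_num at hD; linarith
  rcases lt_or_ge ((-c) ^ 2 - 4 * D) 0 with hd | hd
  · obtain ⟨z, hz, him, hre, hn⟩ := exists_root_complex hd
    obtain ⟨α, hα⟩ := rep_complex z hz him hh
    have hlt : |‖z‖| < |c| := by rw [← sq_lt_sq, hn]; exact hD
    have ht := ((ratio_pow_tendsto hlt).norm).const_mul ‖α‖
    rw [norm_zero, mul_zero] at ht
    refine squeeze_zero_norm (fun k => ?_) ht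
    rw [hα, norm_div, norm_div, ← mul_div_assoc]
    refine div_le_div_of_nonneg_right ?_ (norm_nonneg _)
    refine (Complex.abs_re_le_norm _).trans ?_
    simp
  · have hsq : Real.sqrt ((-c) ^ 2 - 4 * D) ^ 2 = (-c) ^ 2 - 4 * D := Real.sq_sqrt hd
    obtain ⟨lam, mu, h1, h2⟩ : ∃ lam mu : ℝ, -c = lam + mu ∧ D = lam * mu :=
      ⟨(-c + Real.sqrt ((-c) ^ 2 - 4 * D)) / 2, (-c - Real.sqrt ((-c) ^ 2 - 4 * D)) / 2,
        by ring, by nlinarith⟩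
    obtain rfl : c = -(lam + mu) := by linarith
    subst h2
    have hl : |lam / -(lam + mu)| < 1 := by
      rw [abs_div, div_lt_one (abs_pos.2 hc0), ← sq_lt_sq]
      have : mu ≠ 0 := by rintro rfl; simp at hD0
      have : 0 < mu ^ 2 := by positivity
      nlinarith
    have hm : |mu / -(lam + mu)| < 1 := by
      rw [abs_div, div_lt_one (abs_pos.2 hc0), ← sq_lt_sq]
      have : lam ≠ 0 := by rintro rfl; simp at hD0
      have : 0 < lam ^ 2 := by positivity
      nlinarith
    have hg := geo (x := fun k => h (k + 1) - lam * h k) (c := mu)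
      (by intro k; simp only [hh]; ring)
    generalize hcc : -(lam + mu) = c at *
    refine tendsto_zero_of_contract (lam / c) (mu / c) ((h 1 - lam * h 0) / c) hl hm ?_
    intro k
    have h3 := hg k
    simp only [zero_add] at h3
    have h4 : h (k + 1) = lam * h k + (h 1 - lam * h 0) * mu ^ k := by linarith
    rw [h4, div_pow, pow_succ]
    have := pow_ne_zero k hc0
    field_simp

/-- real cubic root decomposition -/
lemma cubic_decomp {f : ℕ → ℝ} {a b c : ℝ} (hf : ∀ k, f (k + 3) = a * f (k + 1) + b * f k)
    (hc : c ^ 3 = a * c + b) (hq : 3 * c ^ 2 - a ≠ 0) :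
    ∃ (γ : ℝ) (h : ℕ → ℝ), (∀ k, f k = γ * c ^ k + h k) ∧
      ∀ k, h (k + 2) = (-c) * h (k + 1) - (c ^ 2 - a) * h k := by
  have hg := geo (x := fun k => f (k + 2) + c * f (k + 1) + (c ^ 2 - a) * f k) (c := c)
    (by intro k; simp only [hf]; linear_combination -f k * hc)
  refine ⟨(f 2 + c * f 1 + (c ^ 2 - a) * f 0) / (3 * c ^ 2 - a),
    fun k => f k - (f 2 + c * f 1 + (c ^ 2 - a) * f 0) / (3 * c ^ 2 - a) * c ^ k,
    fun k => by ring, fun k => ?_⟩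
  have h1 := hg k
  simp only [zero_add] at h1
  have h2 : (f 2 + c * f 1 + (c ^ 2 - a) * f 0) / (3 * c ^ 2 - a) * (3 * c ^ 2 - a)
      = f 2 + c * f 1 + (c ^ 2 - a) * f 0 := div_mul_cancel₀ _ hq
  generalize (f 2 + c * f 1 + (c ^ 2 - a) * f 0) / (3 * c ^ 2 - a) = g at *
  rw [← h2] at h1
  simp only [pow_add]
  linear_combination h1

lemma good_three {f : ℕ → ℝ} (a b : ℤ) (hf : ∀ k, f (k + 3) = a * f (k + 1) + b * f k) :
    Good (QS f (fun k => f (k + 1))) := by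
  by_cases hb : b = 0
  · subst hb
    apply Good.of_shift 1
    refine Good.of_periodic 2 (by norm_num) a ?_ ?_
    · intro k; have := hf k; simp at this; exact this
    · intro k; have := hf (k + 1); simp at this; exact this
  have hbR : (b : ℝ) ≠ 0 := by exact_mod_cast hb
  rcases lt_trichotomy a 0 with ha | ha | ha
  · have haR : (a : ℝ) < 0 := by exact_mod_cast ha
    obtain ⟨c, hc⟩ : ∃ c : ℝ, c ^ 3 = a * c + b := by
      have hcont : Continuous fun x : ℝ => x ^ 3 - a * x := by fun_prop
      obtain ⟨c, hc⟩ := mem_range_of_exists_le_of_exists_ge hcont (c := (b : ℝ))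
        ⟨-(|b| + 1), by
          have := neg_abs_le (b : ℝ); have h2 := abs_nonneg (b : ℝ); push_cast
          generalize |(b : ℝ)| = q at *
          have : (a : ℝ) ≤ -1 := by exact_mod_cast (by omega : a ≤ -1)
          nlinarith [pow_pos (by linarith : 0 < q + 1) 3, mul_nonneg (by linarith : 0 ≤ q + 1) (by linarith : 0 ≤ -(a : ℝ) - 1)]⟩
        ⟨|b| + 1, by
          have := le_abs_self (b : ℝ); have h2 := abs_nonneg (b : ℝ); push_cast
          generalize |(b : ℝ)| = q at *
          have : (a : ℝ) ≤ -1 := by exact_mod_cast (by omega : a ≤ -1)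
          nlinarith [pow_pos (by linarith : 0 < q + 1) 3, mul_nonneg (by linarith : 0 ≤ q + 1) (by linarith : 0 ≤ -(a : ℝ) - 1)]⟩
      exact ⟨c, by linarith⟩
    obtain ⟨γ, h, hfh, hh⟩ := cubic_decomp hf hc (by nlinarith [sq_nonneg c])
    obtain ⟨z, hz, him, hre, hn⟩ := exists_root_complex (T := -c) (D := c ^ 2 - a) (by nlinarith [sq_nonneg c])
    obtain ⟨α, hα⟩ := rep_complex z hz him hh
    have hz0 : z ≠ 0 := by rintro rfl; simp at him
    by_cases hα0 : α = 0
    · refine Good.of_prop (s := fun k => c ^ k) γ (γ * c) ?_ ?_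
      · intro k; rw [hfh, hα, hα0]; simp
      · intro k; rw [hfh, hα, hα0]; simp; ring
    · left
      have hlt : |c| < |‖z‖| := by
        rw [← sq_lt_sq, hn]; linarith
      have ht := ratio_pow_tendsto hlt
      refine dense_complex (e := fun k => γ * c ^ k) (e' := fun k => γ * c ^ (k + 1)) z hz0
        (fun k hk => no_root_unity a b ha hb c hc z hz hre hn k hk) α (α * z) ?_ ?_ ?_ ?_ ?_
      · rw [map_mul, ← mul_assoc, Complex.mul_conj', ← Complex.ofReal_pow, Complex.im_ofReal_mul]
        simp [hα0, him]
      · have := ht.const_mul γ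
        rw [mul_zero] at this
        exact this.congr fun k => by ring
      · have := ht.const_mul (γ * c)
        rw [mul_zero] at this
        exact this.congr fun k => by ring
      · intro k; rw [hfh, hα]; ring
      · intro k; rw [hfh, hα, pow_succ z, mul_assoc α z, mul_comm z]; ring
  · subst ha
    refine Good.of_periodic 3 (by norm_num) b ?_ ?_
    · intro k; rw [hf]; simp
    · intro k; have := hf (k + 1); simp at this; exact this
  · have haR : (0 : ℝ) < a := by exact_mod_cast ha
    obtain ⟨c, hc, hca⟩ : ∃ c : ℝ, c ^ 3 = a * c + b ∧ (a : ℝ) < c ^ 2 :=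
      exists_big_root haR hbR
    have hc0 : c ≠ 0 := by rintro rfl; simp at hca; linarith
    obtain ⟨γ, h, hfh, hh⟩ := cubic_decomp hf hc (by nlinarith [sq_nonneg c])
    by_cases hγ : γ = 0
    · have : f = h := by ext k; rw [hfh, hγ]; ring
      rw [this]
      exact good_two (-c) (c ^ 2 - a) hh (fun k => hh (k + 1))
    have hlim : Tendsto (fun k => h k / c ^ k) atTop (𝓝 0) :=
      decay hh (by linarith) (by linarith)
    have hL : Tendsto (fun k => f k / c ^ k) atTop (𝓝 γ) := by
      have := hlim.const_add γ
      rw [add_zero] at this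
      refine this.congr fun k => ?_
      rw [hfh]
      have := pow_ne_zero k hc0
      field_simp
    refine Good.of_dominant (s := fun k => c ^ k) γ (c * γ)
      (Eventually.of_forall fun k => pow_ne_zero k hc0) hL ?_ (Or.inl hγ)
    have := (hL.comp (tendsto_add_atTop_nat 1)).const_mul c
    refine this.congr fun k => ?_
    simp only [Function.comp]
    have := pow_ne_zero k hc0
    field_simp
    ring

/-- transfer matrix -/
noncomputable def AM (a b : ℤ) (v : ℕ) : Matrix (Fin 3) (Fin 3) ℝ :=
  if v = 0 then !![0, 1, 0; 0, 0, 1; 0, (b : ℝ), (a : ℝ)] else !![0, 1, 0; 0, 0, 1; (b : ℝ), (a : ℝ), 0]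

/-- products of transfer matrices -/
noncomputable def PM (a b : ℤ) (u : ℕ → ℕ) (n : ℕ) : ℕ → Matrix (Fin 3) (Fin 3) ℝ
  | 0 => 1
  | (j + 1) => AM a b (u (n + j + 3)) * PM a b u n j

/-- state vector -/
def SV (f : ℕ → ℤ) (n : ℕ) : Fin 3 → ℝ := ![(f n : ℝ), f (n + 1), f (n + 2)]

lemma SV_step (a b : ℤ) (u : ℕ → ℕ) (hu : ∀ n, u n = 0 ∨ u n = 1) (f : ℕ → ℤ)
    (hfrec : ∀ n, 3 ≤ n → f n = a * f (n - u n - 1) + b * f (n - u n - 2)) (n : ℕ) :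
    SV f (n + 1) = (AM a b (u (n + 3))).mulVec (SV f n) := by
  have h := hfrec (n + 3) (by omega)
  rcases hu (n + 3) with h0 | h0
  · rw [h0] at h
    have h' : f (n + 3) = a * f (n + 2) + b * f (n + 1) := by simpa using h
    ext i
    fin_cases i <;> simp [SV, AM, h0, Matrix.mulVec, dotProduct, Fin.sum_univ_three]
    rw [h']; push_cast; ring
  · rw [h0] at h
    have h' : f (n + 3) = a * f (n + 1) + b * f n := by simpa using h
    ext i
    fin_cases i <;> simp [SV, AM, h0, Matrix.mulVec, dotProduct, Fin.sum_univ_three]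
    rw [h']; push_cast; ring

lemma SV_prod (a b : ℤ) (u : ℕ → ℕ) (hu : ∀ n, u n = 0 ∨ u n = 1) (f : ℕ → ℤ)
    (hfrec : ∀ n, 3 ≤ n → f n = a * f (n - u n - 1) + b * f (n - u n - 2)) (n j : ℕ) :
    SV f (n + j) = (PM a b u n j).mulVec (SV f n) := by
  induction j with
  | zero => simp [PM]
  | succ j ih =>
    rw [← add_assoc, SV_step a b u hu f hfrec, ih, Matrix.mulVec_mulVec, PM]

lemma PM_det_zero (a b : ℤ) (u : ℕ → ℕ) (n l j : ℕ) (hj : j < l) (h : u (n + j + 3) = 0) :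
    (PM a b u n l).det = 0 := by
  induction l with
  | zero => omega
  | succ l ih =>
    rw [PM, Matrix.det_mul]
    rcases Nat.lt_succ_iff_lt_or_eq.1 hj with h1 | h1
    · rw [ih h1, mul_zero]
    · subst h1
      rw [h, AM, if_pos rfl, Matrix.det_fin_three]; simp

lemma PM_congr (a b : ℤ) (u : ℕ → ℕ) (n n' l : ℕ) (h : ∀ j, u (n + j + 3) = u (n' + j + 3)) :
    PM a b u n l = PM a b u n' l := by
  induction l with
  | zero => rfl
  | succ l ih => rw [PM, PM, ih, h]

lemma cayley3 (M : Matrix (Fin 3) (Fin 3) ℝ) (h : M.det = 0) :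
    ∃ T D : ℝ, M * M * M = T • (M * M) - D • M := by
  refine ⟨M 0 0 + M 1 1 + M 2 2, M 0 0 * M 1 1 - M 0 1 * M 1 0 + M 0 0 * M 2 2 - M 0 2 * M 2 0
    + M 1 1 * M 2 2 - M 1 2 * M 2 1, ?_⟩
  rw [Matrix.det_fin_three] at h
  ext i j
  fin_cases i <;> fin_cases j <;> simp [Matrix.mul_apply, Fin.sum_univ_three] <;>
    first | ring1 | linear_combination h

lemma good_residue (a b : ℤ) (u : ℕ → ℕ) (hu : ∀ n, u n = 0 ∨ u n = 1) (f : ℕ → ℤ)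
    (hfrec : ∀ n, 3 ≤ n → f n = a * f (n - u n - 1) + b * f (n - u n - 2))
    (l m : ℕ) (hper : ∀ n, m ≤ n → u (n + l) = u n) (r : ℕ) (hr : m ≤ r)
    (h0 : ∃ j < l, u (r + j + 3) = 0) :
    Good (QS (fun k => (f (r + l * k) : ℝ)) (fun k => (f (r + l * k + 1) : ℝ))) := by
  obtain ⟨j, hj, h0⟩ := h0
  obtain ⟨T, D, hTD⟩ := cayley3 _ (PM_det_zero a b u r l j hj h0)
  have hp : ∀ k n, m ≤ n → u (n + l * k) = u n := by
    intro k
    induction k with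
    | zero => simp
    | succ k ih =>
      intro n hn
      rw [Nat.mul_succ, ← add_assoc, hper _ (by omega), ih n hn]
  have hs : ∀ k, SV f (r + l * (k + 1)) = (PM a b u r l).mulVec (SV f (r + l * k)) := by
    intro k
    rw [Nat.mul_succ, ← add_assoc, SV_prod a b u hu f hfrec]
    congr 1
    apply PM_congr
    intro j
    rw [show r + l * k + j + 3 = (r + j + 3) + l * k by ring]
    exact hp k _ (by omega)
  have hrec : ∀ k, SV f (r + l * (k + 3)) = T • SV f (r + l * (k + 2)) - D • SV f (r + l * (k + 1)) := by
    intro k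
    rw [show k + 3 = k + 1 + 1 + 1 by ring, show k + 2 = k + 1 + 1 by ring, hs (k + 1 + 1), hs (k + 1),
      hs k, Matrix.mulVec_mulVec, Matrix.mulVec_mulVec, hTD, Matrix.sub_mulVec, Matrix.smul_mulVec,
      Matrix.smul_mulVec, Matrix.mulVec_mulVec]
  apply Good.of_shift 1
  refine good_two T D ?_ ?_
  · intro k
    have := congrFun (hrec k) 0
    simpa [SV] using this
  · intro k
    have := congrFun (hrec k) 1
    simpa [SV] using this

theorem stmt13 (a b : ℤ) (u : ℕ → ℕ) (hu : ∀ n, u n = 0 ∨ u n = 1)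
    (f : ℕ → ℤ)
    (hf0 : f 0 = 1) (hf1 : f 1 = 1) (hf2 : f 2 = a + b)
    (hfrec : ∀ n, 3 ≤ n → f n = a * f (n - u n - 1) + b * f (n - u n - 2))
    (l m : ℕ) (hl : 1 ≤ l)
    (hper : ∀ n, m ≤ n → u (n + l) = u n)
    (V : Set ℝ)
    (hV : V = {x : ℝ | ∃ n : ℕ, f n ≠ 0 ∧ x = (f (n + 1) : ℝ) / (f n : ℝ)})
    (W : Set (OnePoint ℝ)) (hW : W = (fun x : ℝ => (x : OnePoint ℝ)) '' V) :
    V.Finite ∨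
    ({p : OnePoint ℝ | AccPt p (𝓟 W)}.Finite ∧
      {p : OnePoint ℝ | AccPt p (𝓟 W)}.ncard ≤ l) ∨
    Dense V := by
  right
  have hVQ : V = QS (fun n => (f n : ℝ)) (fun n => (f (n + 1) : ℝ)) := by
    rw [hV]; ext x; simp [QS]
  have hAP : {p : OnePoint ℝ | AccPt p (𝓟 W)} = AP V := by rw [hW]; rfl
  rw [hAP]
  by_cases hB : ∃ N, ∀ n, N ≤ n → u n = 1
  · obtain ⟨N, hN⟩ := hB
    have hG : Good V := by
      rw [hVQ]
      apply Good.of_shift N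
      have := good_three (f := fun k => (f (k + N) : ℝ)) a b (by
        intro k
        have h := hfrec (k + N + 3) (by omega)
        rw [hN _ (by omega)] at h
        have h' : f (k + N + 3) = a * f (k + N + 1) + b * f (k + N) := by simpa using h
        simp only [show k + 3 + N = k + N + 3 by ring, show k + 1 + N = k + N + 1 by ring, h']
        push_cast; ring)
      simpa only [add_right_comm] using this
    rcases hG with h | h
    · exact Or.inr h
    · exact Or.inl ⟨h.finite, (Set.ncard_le_one h.finite).2 (fun x hx y hy => h hx hy) |>.trans hl⟩
  · have hres : ∀ r, m ≤ r → ∃ j < l, u (r + j + 3) = 0 := by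
      intro r hr
      by_contra hcon
      push Not at hcon
      apply hB
      refine ⟨r + 3, fun n => ?_⟩
      induction n using Nat.strong_induction_on with
      | _ n ih =>
        intro hn
        by_cases h : n < r + 3 + l
        · have := hcon (n - (r + 3)) (by omega)
          rw [show r + (n - (r + 3)) + 3 = n by omega] at this
          exact (hu n).resolve_left this
        · have := hper (n - l) (by omega)
          rw [Nat.sub_add_cancel (by omega)] at this
          rw [this]
          exact ih (n - l) (by omega) (by omega)
    set Q : ℕ → Set ℝ := fun i =>
      QS (fun k => (f (m + i + l * k) : ℝ)) (fun k => (f (m + i + l * k + 1) : ℝ)) with hQ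
    have hgood : ∀ i, Good (Q i) := fun i =>
      good_residue a b u hu f hfrec l m hper (m + i) (by omega) (hres _ (by omega))
    by_cases hd : ∃ i, Dense (Q i)
    · right
      obtain ⟨i, hi⟩ := hd
      refine hi.mono ?_
      rw [hVQ]
      rintro t ⟨k, hk, rfl⟩
      exact ⟨_, hk, rfl⟩
    · left
      push Not at hd
      have hss : ∀ i, (AP (Q i)).Subsingleton := fun i => (hgood i).resolve_left (hd i)
      have hsub : AP V ⊆ ⋃ i ∈ Finset.range l, AP (Q i) := by
        rw [← AP_biUnion]
        have h1 : V ⊆ ((fun k => (f (k + 1) : ℝ) / f k) '' (Set.Iio m)) ∪ ⋃ i ∈ Finset.range l, Q i := by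
          rw [hVQ]
          rintro t ⟨n, hn, rfl⟩
          rcases lt_or_ge n m with h | h
          · left; exact ⟨n, h, rfl⟩
          · right
            simp only [Set.mem_iUnion, Finset.mem_range]
            refine ⟨(n - m) % l, Nat.mod_lt _ hl, (n - m) / l, ?_⟩
            have : m + (n - m) % l + l * ((n - m) / l) = n := by
              have := Nat.mod_add_div (n - m) l
              omega
            simp only [this]
            exact ⟨hn, trivial⟩
        have h2 := AP_mono h1
        rwa [AP_union, AP_finite ((Set.finite_Iio m).image _), Set.empty_union] at h2
      have hfin : (⋃ i ∈ Finset.range l, AP (Q i)).Finite :=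
        (Finset.range l).finite_toSet.biUnion fun i _ => (hss i).finite
      refine ⟨hfin.subset hsub, (Set.ncard_le_ncard hsub hfin).trans ?_⟩
      refine (Finset.set_ncard_biUnion_le (Finset.range l) _).trans ?_
      refine (Finset.sum_le_card_nsmul _ _ 1 fun i _ => ?_).trans (by simp)
      exact (Set.ncard_le_one (hss i).finite).2 (fun x hx y hy => hss i hx hy)
end
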